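/- Let u : ℝ × ℝ² → ℝ² and d : ℝ × ℝ² → ℝ³ be C² functions satisfying the director equation ∂ₜd + (u·∇)d = Δd + |∇d|²·d at every point (t, x₁, x₂) with x₂ > 0. Define, for x₂ < 0, the reflected fields ũ(t,x₁,x₂) = ( u₁(t,x₁,−x₂), −u₂(t,x₁,−x₂) ) and d̃(t,x₁,x₂) = ( d₁(t,x₁,−x₂), d₂(t,x₁,−x₂), −d₃(t,x₁,−x₂) ). Then ∂ₜd̃ + (ũ·∇)d̃ = Δd̃ + |∇d̃|²·d̃ at every point (t,x₁,x₂) with x₂ < 0. -/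

import Mathlib

open scoped BigOperators

noncomputable section

abbrev E2 := EuclideanSpace ℝ (Fin 2)
abbrev E3 := EuclideanSpace ℝ (Fin 3)

/-- Time derivative `∂ₜf` of a scalar function of `(t, x) ∈ ℝ × ℝ²`. -/
noncomputable def dt (f : ℝ × E2 → ℝ) (p : ℝ × E2) : ℝ :=
  fderiv ℝ f p ((1 : ℝ), (0 : E2))

/-- Spatial partial derivative `∂ᵢf` of a scalar function of `(t, x) ∈ ℝ × ℝ²`. -/
noncomputable def ds (i : Fin 2) (f : ℝ × E2 → ℝ) (p : ℝ × E2) : ℝ :=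
  fderiv ℝ f p ((0 : ℝ), EuclideanSpace.single i 1)

/-- Spatial Laplacian `Δf = ∂₁₁f + ∂₂₂f`. -/
noncomputable def lap (f : ℝ × E2 → ℝ) (p : ℝ × E2) : ℝ :=
  ds 0 (fun q => ds 0 f q) p + ds 1 (fun q => ds 1 f q) p

/-- `|∇d|² = Σᵢⱼ (∂ᵢdⱼ)²` (spatial gradient). -/
noncomputable def gradSq (d : ℝ × E2 → E3) (p : ℝ × E2) : ℝ :=
  ∑ i : Fin 2, ∑ k : Fin 3, (ds i (fun q => d q k) p) ^ 2

/-- The director equation `∂ₜd + (u·∇)d = Δd + |∇d|² d` at a point, componentwise. -/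
def directorEq (u : ℝ × E2 → E2) (d : ℝ × E2 → E3) (p : ℝ × E2) : Prop :=
  ∀ k : Fin 3,
    dt (fun q => d q k) p + (∑ j : Fin 2, u p j * ds j (fun q => d q k) p)
      = lap (fun q => d q k) p + gradSq d p * d p k

/-- Reflection `(t, x₁, x₂) ↦ (t, x₁, -x₂)` of a space-time point. -/
noncomputable def reflPt (p : ℝ × E2) : ℝ × E2 :=
  (p.1, EuclideanSpace.single 0 (p.2 0) + EuclideanSpace.single 1 (-(p.2 1)))

/-- Reflected velocity field: `ũ(t,x₁,x₂) = (u₁(t,x₁,-x₂), -u₂(t,x₁,-x₂))`. -/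
noncomputable def reflU (u : ℝ × E2 → E2) (p : ℝ × E2) : E2 :=
  EuclideanSpace.single 0 (u (reflPt p) 0) + EuclideanSpace.single 1 (-(u (reflPt p) 1))

/-- Reflected director field:
`d̃(t,x₁,x₂) = (d₁(t,x₁,-x₂), d₂(t,x₁,-x₂), -d₃(t,x₁,-x₂))`. -/
noncomputable def reflD (d : ℝ × E2 → E3) (p : ℝ × E2) : E3 :=
  EuclideanSpace.single 0 (d (reflPt p) 0) + EuclideanSpace.single 1 (d (reflPt p) 1)
    + EuclideanSpace.single 2 (-(d (reflPt p) 2))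

/-- The reflection `reflPt` as a continuous linear equivalence. -/
noncomputable def reflEquiv : (ℝ × E2) ≃L[ℝ] (ℝ × E2) :=
  LinearEquiv.toContinuousLinearEquiv
    (LinearEquiv.ofInvolutive
      { toFun := reflPt
        map_add' := fun p q => by
          refine Prod.ext rfl ?_
          ext i
          fin_cases i <;> simp [reflPt]
          ring
        map_smul' := fun c p => by
          refine Prod.ext rfl ?_
          ext i
          fin_cases i <;> simp [reflPt] }
      fun p => by
        refine Prod.ext rfl ?_
        ext i
        fin_cases i <;> simp [reflPt])

theorem fderiv_comp_reflPt (f : ℝ × E2 → ℝ) (p v : ℝ × E2) :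
    fderiv ℝ (fun q => f (reflPt q)) p v = fderiv ℝ f (reflPt p) (reflPt v) :=
  congrArg (fun L : (ℝ × E2) →L[ℝ] ℝ => L v) (reflEquiv.comp_right_fderiv (f := f) (x := p))

theorem dt_comp_reflPt (f : ℝ × E2 → ℝ) (p : ℝ × E2) :
    dt (fun q => f (reflPt q)) p = dt f (reflPt p) := by
  have h : reflPt ((1 : ℝ), (0 : E2)) = (1, 0) := by
    refine Prod.ext rfl ?_
    ext i
    fin_cases i <;> simp [reflPt]
  rw [dt, fderiv_comp_reflPt, h, dt]

theorem ds_zero_comp_reflPt (f : ℝ × E2 → ℝ) (p : ℝ × E2) :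
    ds 0 (fun q => f (reflPt q)) p = ds 0 f (reflPt p) := by
  have h : reflPt ((0 : ℝ), EuclideanSpace.single 0 1) = (0, EuclideanSpace.single 0 1) := by
    refine Prod.ext rfl ?_
    ext i
    fin_cases i <;> simp [reflPt]
  rw [ds, fderiv_comp_reflPt, h, ds]

theorem ds_one_comp_reflPt (f : ℝ × E2 → ℝ) (p : ℝ × E2) :
    ds 1 (fun q => f (reflPt q)) p = -ds 1 f (reflPt p) := by
  have h : reflPt ((0 : ℝ), EuclideanSpace.single 1 1) = -(0, EuclideanSpace.single 1 1) := by
    refine Prod.ext (by simp [reflPt]) ?_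
    ext i
    fin_cases i <;> simp [reflPt]
  rw [ds, fderiv_comp_reflPt, h, map_neg, ds]

theorem dt_neg (f : ℝ × E2 → ℝ) (p : ℝ × E2) : dt (fun q => -f q) p = -dt f p := by
  simp [dt, fderiv_fun_neg]

theorem ds_neg (i : Fin 2) (f : ℝ × E2 → ℝ) (p : ℝ × E2) :
    ds i (fun q => -f q) p = -ds i f p := by
  simp [ds, fderiv_fun_neg]

theorem lap_neg (f : ℝ × E2 → ℝ) (p : ℝ × E2) : lap (fun q => -f q) p = -lap f p := by
  simp only [lap, ds_neg]
  ring

theorem lap_comp_reflPt (f : ℝ × E2 → ℝ) (p : ℝ × E2) :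
    lap (fun q => f (reflPt q)) p = lap f (reflPt p) := by
  simp only [lap, ds_zero_comp_reflPt, ds_one_comp_reflPt, ds_neg, neg_neg]

theorem reflU_zero (u : ℝ × E2 → E2) (p : ℝ × E2) : reflU u p 0 = u (reflPt p) 0 := by
  simp [reflU]

theorem reflU_one (u : ℝ × E2 → E2) (p : ℝ × E2) : reflU u p 1 = -u (reflPt p) 1 := by
  simp [reflU]

theorem reflD_zero (d : ℝ × E2 → E3) (p : ℝ × E2) : reflD d p 0 = d (reflPt p) 0 := by
  simp [reflD]

theorem reflD_one (d : ℝ × E2 → E3) (p : ℝ × E2) : reflD d p 1 = d (reflPt p) 1 := by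
  simp [reflD]

theorem reflD_two (d : ℝ × E2 → E3) (p : ℝ × E2) : reflD d p 2 = -d (reflPt p) 2 := by
  simp [reflD]

theorem ds_zero_comp_reflPt_apply (d : ℝ × E2 → E3) (k : Fin 3) (p : ℝ × E2) :
    ds 0 (fun q => d (reflPt q) k) p = ds 0 (fun q => d q k) (reflPt p) :=
  ds_zero_comp_reflPt (fun q => d q k) p

theorem ds_one_comp_reflPt_apply (d : ℝ × E2 → E3) (k : Fin 3) (p : ℝ × E2) :
    ds 1 (fun q => d (reflPt q) k) p = -ds 1 (fun q => d q k) (reflPt p) :=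
  ds_one_comp_reflPt (fun q => d q k) p

theorem gradSq_reflD (d : ℝ × E2 → E3) (p : ℝ × E2) :
    gradSq (reflD d) p = gradSq d (reflPt p) := by
  simp only [gradSq, Fin.sum_univ_two, Fin.sum_univ_three, reflD_zero, reflD_one, reflD_two,
    ds_neg, ds_zero_comp_reflPt_apply, ds_one_comp_reflPt_apply, neg_sq]

/-- If `(u, d)` are `C²` and satisfy the director equation
`∂ₜd + (u·∇)d = Δd + |∇d|² d` on the upper half-plane `{x₂ > 0}`, then the reflected
fields `(ũ, d̃)` satisfy the same equation on the lower half-plane `{x₂ < 0}`. -/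
theorem director_equation_reflection
    (u : ℝ × E2 → E2) (d : ℝ × E2 → E3)
    (hu : ContDiff ℝ 2 u) (hd : ContDiff ℝ 2 d)
    (heq : ∀ p : ℝ × E2, 0 < p.2 1 → directorEq u d p) :
    ∀ p : ℝ × E2, p.2 1 < 0 → directorEq (reflU u) (reflD d) p := by
  intro p hp k
  have hpos : 0 < (reflPt p).2 1 := by simpa [reflPt] using hp
  have h := heq (reflPt p) hpos k
  have ht := dt_comp_reflPt (fun q => d q k) p
  have hl := lap_comp_reflPt (fun q => d q k) p
  rw [gradSq_reflD]
  rw [Fin.sum_univ_two] at h ⊢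
  fin_cases k <;>
    simp only [Fin.zero_eta, Fin.mk_one, Fin.reduceFinMk, reflU_zero, reflU_one, reflD_zero,
      reflD_one, reflD_two, dt_neg, ds_neg, lap_neg, ds_zero_comp_reflPt_apply,
      ds_one_comp_reflPt_apply] at h ht hl ⊢ <;>
    rw [ht, hl] <;> linarith

end
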